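/- Define Θ₃(t,u,v,w) := Θ(tu″, ū′, w″v, w̄′) ∈ Ω̃₂ (Sweedler summation implicit). Then in Ω̃₂ (notation of the context), for all t, u, v, w, a ∈ T one has Θ₃(t, u, va, w) − Θ₃(at, u, v, w) + Θ(t, u, va, w) − Θ(at, u, v, w) = 0. (Lemma 3.2(1) of the paper, transported through the presentation of the 2-loop space Ω̃₂ given by Theorem 1.1, where Θ₃ is the image of the theta graph whose two dotted edges lie on the middle and right strands.) -/

import Mathlib

open TensorProduct

set_option maxSynthPendingDepth 4

noncomputable section

/-- The symplectic vector space `H = ℚ^{2g}`. -/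
abbrev Hsp (g : ℕ) : Type := Fin (2 * g) → ℚ

/-- The tensor algebra `T = T(H)`. -/
abbrev TA (g : ℕ) : Type := TensorAlgebra ℚ (Hsp g)

/-- The antipode `x ↦ x̄`, determined by `overline (u₁⋯u_m) = (−1)^m u_m⋯u₁`. -/
def barT (g : ℕ) : TA g →ₗ[ℚ] TA g :=
  (MulOpposite.opLinearEquiv ℚ (M := TA g)).symm.toLinearMap ∘ₗ
    (TensorAlgebra.lift ℚ
      ((MulOpposite.opLinearEquiv ℚ (M := TA g)).toLinearMap ∘ₗ
        (-(TensorAlgebra.ι ℚ (M := Hsp g))))).toLinearMap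

/-- The coproduct `Δ : T → T ⊗ T`, the algebra homomorphism with
`Δ(u) = u ⊗ 1 + 1 ⊗ u` for `u ∈ H`. -/
def comul (g : ℕ) : TA g →ₗ[ℚ] TA g ⊗[ℚ] TA g :=
  (TensorAlgebra.lift ℚ
    (((TensorProduct.mk ℚ (TA g) (TA g)).flip 1) ∘ₗ TensorAlgebra.ι ℚ
      + (TensorProduct.mk ℚ (TA g) (TA g) 1) ∘ₗ TensorAlgebra.ι ℚ)).toLinearMap

/-- `T ⊗ T ⊗ T ⊗ T`. -/
abbrev T4 (g : ℕ) : Type := TA g ⊗[ℚ] (TA g ⊗[ℚ] (TA g ⊗[ℚ] TA g))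

/-- The generator `Θ(t,u,v,w)`, i.e. `t ⊗ u ⊗ v ⊗ w`. -/
def Th (g : ℕ) (t u v w : TA g) : T4 g := t ⊗ₜ[ℚ] (u ⊗ₜ[ℚ] (v ⊗ₜ[ℚ] w))

/-- The second term `Θ(t̄′, t″u, v̄′, wv″)` of the (GC3) relation
(Sweedler summation implicit). -/
def gc3B (g : ℕ) (t u v w : TA g) : T4 g :=
  (TensorProduct.assoc ℚ (TA g) (TA g) (TA g ⊗[ℚ] TA g))
    ((TensorProduct.map (barT g) (LinearMap.mulRight ℚ u)) (comul g t) ⊗ₜ[ℚ]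
     (TensorProduct.map (barT g) (LinearMap.mulLeft ℚ w)) (comul g v))

/-- The third term `Θ(tu″, ū′, w″v, w̄′)` of the (GC3) relation
(Sweedler summation implicit). -/
def gc3C (g : ℕ) (t u v w : TA g) : T4 g :=
  (TensorProduct.assoc ℚ (TA g) (TA g) (TA g ⊗[ℚ] TA g))
    ((TensorProduct.comm ℚ (TA g) (TA g)
        ((TensorProduct.map (barT g) (LinearMap.mulLeft ℚ t)) (comul g u))) ⊗ₜ[ℚ]
     (TensorProduct.comm ℚ (TA g) (TA g)
        ((TensorProduct.map (barT g) (LinearMap.mulRight ℚ v)) (comul g w))))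

/-- The full (GC3) element `Θ(t,u,v,w) + Θ(t̄′,t″u,v̄′,wv″) + Θ(tu″,ū′,w″v,w̄′)`. -/
def gc3 (g : ℕ) (t u v w : TA g) : T4 g :=
  Th g t u v w + gc3B g t u v w + gc3C g t u v w

/-- The relations (CS), (HB) and (GC3) defining `Ω̃₂`. -/
def OmegaRel (g : ℕ) : Set (T4 g) :=
  {x | (∃ t u v w : TA g,
          x = Th g t u v w - Th g (barT g v) (barT g w) (barT g t) (barT g u)) ∨
       (∃ t u v w : TA g,
          x = Th g t u v w - Th g (barT g u) (barT g t) (barT g w) (barT g v)) ∨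
       (∃ (t u v w : TA g) (a : Hsp g),
          x = Th g t u v (w * TensorAlgebra.ι ℚ a)
              - Th g t u (TensorAlgebra.ι ℚ a * v) w
              - Th g t (TensorAlgebra.ι ℚ a * u) v w
              + Th g (t * TensorAlgebra.ι ℚ a) u v w) ∨
       (∃ t u v w : TA g, x = gc3 g t u v w)}

/-- The 2-loop space `Ω̃₂`. -/
abbrev Omega2 (g : ℕ) : Type := T4 g ⧸ Submodule.span ℚ (OmegaRel g)

/-- The class `Θ(t,u,v,w) ∈ Ω̃₂`. -/
def ThO (g : ℕ) (t u v w : TA g) : Omega2 g := Submodule.Quotient.mk (Th g t u v w)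

/-- The image `Θ₃(t,u,v,w)` in `Ω̃₂` of the theta graph whose two dotted edges lie on
the middle and right strands, i.e. the class of `Θ(tu″, ū′, w″v, w̄′)`
(Sweedler summation implicit). -/
def Th3 (g : ℕ) (t u v w : TA g) : Omega2 g := Submodule.Quotient.mk (gc3C g t u v w)

theorem barT_mul (g : ℕ) (x y : TA g) : barT g (x * y) = barT g y * barT g x := by
  simp [barT]

theorem barT_ι (g : ℕ) (a : Hsp g) :
    barT g (TensorAlgebra.ι ℚ a) = -TensorAlgebra.ι ℚ a := by
  simp [barT]

theorem comul_mul (g : ℕ) (x y : TA g) : comul g (x * y) = comul g x * comul g y := by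
  simp [comul]

theorem comul_ι (g : ℕ) (a : Hsp g) :
    comul g (TensorAlgebra.ι ℚ a)
      = TensorAlgebra.ι ℚ a ⊗ₜ[ℚ] 1 + 1 ⊗ₜ[ℚ] TensorAlgebra.ι ℚ a := by
  simp [comul]

/-- The assignment `(t′ ⊗ t″, v′ ⊗ v″) ↦ Θ(t̄′, t″u, v̄′, wv″)`, bilinear in both tensors. -/
def slideMap (g : ℕ) (u w : TA g) :
    TA g ⊗[ℚ] TA g →ₗ[ℚ] TA g ⊗[ℚ] TA g →ₗ[ℚ] Omega2 g :=
  ((TensorProduct.mk ℚ (TA g ⊗[ℚ] TA g) (TA g ⊗[ℚ] TA g)).compl₁₂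
    (TensorProduct.map (barT g) (LinearMap.mulRight ℚ u))
    (TensorProduct.map (barT g) (LinearMap.mulLeft ℚ w))).compr₂
    ((Submodule.span ℚ (OmegaRel g)).mkQ ∘ₗ
      (TensorProduct.assoc ℚ (TA g) (TA g) (TA g ⊗[ℚ] TA g)).toLinearMap)

theorem slideMap_tmul (g : ℕ) (u w p q r s : TA g) :
    slideMap g u w (p ⊗ₜ q) (r ⊗ₜ s) = ThO g (barT g p) (q * u) (barT g r) (w * s) := rfl

theorem ThO_neg_left (g : ℕ) (t u v w : TA g) : ThO g (-t) u v w = -ThO g t u v w := by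
  simp [ThO, Th, TensorProduct.neg_tmul]

theorem ThO_neg_third (g : ℕ) (t u v w : TA g) : ThO g t u (-v) w = -ThO g t u v w := by
  simp [ThO, Th, TensorProduct.neg_tmul, TensorProduct.tmul_neg]

/-- The relation (HB) in the quotient. -/
theorem ThO_slide_ι (g : ℕ) (t u v w : TA g) (a : Hsp g) :
    ThO g t u v (w * TensorAlgebra.ι ℚ a) - ThO g t u (TensorAlgebra.ι ℚ a * v) w
      - ThO g t (TensorAlgebra.ι ℚ a * u) v w + ThO g (t * TensorAlgebra.ι ℚ a) u v w = 0 :=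
  (Submodule.Quotient.mk_eq_zero _).2
    (Submodule.subset_span (Or.inr (Or.inr (Or.inl ⟨t, u, v, w, a, rfl⟩))))

/-- The relation (GC3) in the quotient. -/
theorem ThO_add_slideMap_add_Th3 (g : ℕ) (t u v w : TA g) :
    ThO g t u v w + slideMap g u w (comul g t) (comul g v) + Th3 g t u v w = 0 :=
  (Submodule.Quotient.mk_eq_zero _).2
    (Submodule.subset_span (Or.inr (Or.inr (Or.inr ⟨t, u, v, w, rfl⟩))))

theorem slideMap_mul_ι (g : ℕ) (u w : TA g) (a : Hsp g) (x y : TA g ⊗[ℚ] TA g) :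
    slideMap g u w x (y * comul g (TensorAlgebra.ι ℚ a))
      = slideMap g u w (comul g (TensorAlgebra.ι ℚ a) * x) y := by
  induction x with
  | zero => simp
  | add x₁ x₂ h₁ h₂ => simp only [mul_add, map_add, LinearMap.add_apply, h₁, h₂]
  | tmul p q =>
    induction y with
    | zero => simp
    | add y₁ y₂ h₁ h₂ => simp only [add_mul, map_add, h₁, h₂]
    | tmul r s =>
      have h := ThO_slide_ι g (barT g p) (q * u) (barT g r) (w * s) a
      simp only [comul_ι, mul_add, add_mul, Algebra.TensorProduct.tmul_mul_tmul, mul_one,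
        one_mul, map_add, LinearMap.add_apply, slideMap_tmul, barT_mul, barT_ι, mul_neg,
        neg_mul, ThO_neg_left, ThO_neg_third]
      simp only [mul_assoc] at h ⊢
      rw [← sub_eq_zero, ← h]
      abel

/-- A factor slides from the third entry to the first in `Θ(t̄′, t″u, v̄′, wv″)`. -/
theorem slideMap_comul_mul (g : ℕ) (u w a : TA g) (t v : TA g) :
    slideMap g u w (comul g t) (comul g (v * a))
      = slideMap g u w (comul g (a * t)) (comul g v) := by
  induction a using TensorAlgebra.induction generalizing t v with
  | algebraMap r => simp [← Algebra.commutes r v, ← Algebra.smul_def]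
  | ι a => rw [comul_mul, comul_mul, slideMap_mul_ι]
  | mul a b ha hb => rw [← mul_assoc, hb, ha, mul_assoc]
  | add a b ha hb => simp only [mul_add, add_mul, map_add, LinearMap.add_apply, ha, hb]

/-- Lemma 3.2(1) transported through the presentation of `Ω̃₂`:
`Θ₃(t,u,va,w) − Θ₃(at,u,v,w) + Θ(t,u,va,w) − Θ(at,u,v,w) = 0` in `Ω̃₂`. -/
theorem theta3_slide (g : ℕ) (hg : 1 ≤ g) (t u v w a : TA g) :
    Th3 g t u (v * a) w - Th3 g (a * t) u v w
      + ThO g t u (v * a) w - ThO g (a * t) u v w = 0 := by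
  have h₁ := ThO_add_slideMap_add_Th3 g t u (v * a) w
  have h₂ := ThO_add_slideMap_add_Th3 g (a * t) u v w
  rw [slideMap_comul_mul] at h₁
  rw [← sub_self (0 : Omega2 g)]
  nth_rewrite 1 [← h₁]
  rw [← h₂]
  abel
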